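/- Let G and H be games over a poset A that are premotive and have parity. If G ≤ H in the intrinsic order, then G ≤_c H in the contextual order; that is, o(G+X) ≤ o(H+X) for every context X. -/

import Mathlib

/-- Games over a poset `α`: atomic games `[a]` for `a : α`, and composite games
`⟨L|R⟩` given by nonempty families of left and right options. -/
inductive Game (α : Type) : Type 1 where
  | atom : α → Game α
  | comp : (ι κ : Type) → (ι → Game α) → (κ → Game α) → Nonempty ι → Nonempty κ → Game α

namespace Game

variable {α β : Type}

/-- `G'` is a left option of the game. -/
def IsLeftOption (G' : Game α) : Game α → Prop
  | atom _ => False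
  | comp _ _ L _ _ _ => ∃ i, L i = G'

/-- `G'` is a right option of the game. -/
def IsRightOption (G' : Game α) : Game α → Prop
  | atom _ => False
  | comp _ _ _ R _ _ => ∃ k, R k = G'

/-- `G'` is an option of `G`. -/
def IsOption (G' G : Game α) : Prop := IsLeftOption G' G ∨ IsRightOption G' G

/-- A game is composite if it is not atomic. -/
def IsComposite : Game α → Prop
  | atom _ => False
  | comp _ _ _ _ _ _ => True

/-- `G'` is a follower of `G`: `G` itself, an option of `G`, or recursively a follower
of an option of `G`. -/
def IsFollower (G' G : Game α) : Prop := Relation.ReflTransGen IsOption G' G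

/-- The dual game: Left and Right switch sides; it is a game over the opposite poset. -/
def dual : Game α → Game αᵒᵈ
  | atom a => atom (OrderDual.toDual a)
  | comp ι κ L R hι hκ => comp κ ι (fun k => (R k).dual) (fun i => (L i).dual) hκ hι

/-- The image of a game under a (monotone) function applied to atoms. -/
def map (f : α → β) : Game α → Game β
  | atom a => atom (f a)
  | comp ι κ L R hι hκ => comp ι κ (fun i => (L i).map f) (fun k => (R k).map f) hι hκ

/-- The (disjunctive) sum of a game over `α` and a game over `β`, a game over `α × β`. -/
noncomputable def add : Game α → Game β → Game (α × β) := by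
  intro G
  induction G with
  | atom g =>
    intro H
    induction H with
    | atom h => exact atom (g, h)
    | comp ι κ L R hι hκ IHL IHR => exact comp ι κ IHL IHR hι hκ
  | comp ι κ L R hι hκ IHL IHR =>
    intro H
    induction H with
    | atom h => exact comp ι κ (fun i => IHL i (atom h)) (fun k => IHR k (atom h)) hι hκ
    | comp ι' κ' L' R' hι' hκ' IHL' IHR' =>
      exact comp (ι ⊕ ι') (κ ⊕ κ')
        (Sum.elim (fun i => IHL i (comp ι' κ' L' R' hι' hκ')) IHL')
        (Sum.elim (fun k => IHR k (comp ι' κ' L' R' hι' hκ')) IHR')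
        (hι.elim fun i => ⟨Sum.inl i⟩) (hκ.elim fun k => ⟨Sum.inl k⟩)

mutual
/-- Left has a first player winning strategy in a game over the boolean poset:
either the game is the atom `⊤`, or some left option has a second player
winning strategy for Left. -/
inductive LeftWinsFirst : Game Bool → Prop where
  | atom_top : LeftWinsFirst (atom true)
  | move {G G' : Game Bool} : IsLeftOption G' G → LeftWinsSecond G' → LeftWinsFirst G

/-- Left has a second player winning strategy in a game over the boolean poset:
every right option has a first player winning strategy for Left, and if the game
is atomic it is the atom `⊤`. -/
inductive LeftWinsSecond : Game Bool → Prop where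
  | mk {G : Game Bool} : (∀ G', IsRightOption G' G → LeftWinsFirst G') →
      (∀ b, G = atom b → b = true) → LeftWinsSecond G
end

mutual
/-- A game is even if all of its options are odd (atomic games are even). -/
inductive Even {α : Type} : Game α → Prop where
  | mk {G : Game α} : (∀ G', IsOption G' G → Odd G') → Even G

/-- A game is odd if it is composite and all of its options are even. -/
inductive Odd {α : Type} : Game α → Prop where
  | mk {G : Game α} : G.IsComposite → (∀ G', IsOption G' G → Even G') → Odd G
end

/-- A game has parity if it is even or odd. -/
def HasParity (G : Game α) : Prop := Even G ∨ Odd G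

/-- `G` and `H` have matching parity (both even or both odd). -/
def MatchingParity (G H : Game α) : Prop := (Even G ∧ Even H) ∨ (Odd G ∧ Odd H)

/-- `G` and `H` have mismatching parity (one even, the other odd). -/
def MismatchParity (G H : Game α) : Prop := (Even G ∧ Odd H) ∨ (Odd G ∧ Even H)

mutual
/-- The intrinsic order `G ≤ H` on games over a poset: every left option `G^L` of `G`
satisfies `G^L ◁ H`, every right option `H^R` of `H` satisfies `G ◁ H^R`, and if
both games are atoms `[g]`, `[h]` then `g ≤ h`. -/
inductive Le {α : Type} [PartialOrder α] : Game α → Game α → Prop where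
  | mk {G H : Game α} :
      (∀ G', IsLeftOption G' G → Tri G' H) →
      (∀ H', IsRightOption H' H → Tri G H') →
      (∀ g h, G = atom g → H = atom h → g ≤ h) →
      Le G H

/-- The intrinsic relation `G ◁ H` on games over a poset: some right option `G^R` of `G`
satisfies `G^R ≤ H`, or some left option `H^L` of `H` satisfies `G ≤ H^L`. -/
inductive Tri {α : Type} [PartialOrder α] : Game α → Game α → Prop where
  | inr {G H G' : Game α} : IsRightOption G' G → Le G' H → Tri G H
  | inl {G H H' : Game α} : IsLeftOption H' H → Le G H' → Tri G H
end

/-- The comparison game `λ(Gᵒᵖ + H)`, a game over the boolean poset, where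
`λ : αᵒᵈ × α → 𝔹` is the monotone map with `λ(xᵒᵖ, y) = ⊤` iff `x ≤ y`. -/
noncomputable def comparison [PartialOrder α] (G H : Game α) : Game Bool :=
  map (fun p : αᵒᵈ × α => @decide (OrderDual.ofDual p.1 ≤ p.2) (Classical.propDecidable _))
    (G.dual.add H)

/-- A game is locally premotive if Left has a first player winning strategy in
the comparison game `λ(Gᵒᵖ + G)`. -/
def LocallyPremotive [PartialOrder α] (G : Game α) : Prop := LeftWinsFirst (comparison G G)

/-- A game is premotive if it and all of its followers are locally premotive. -/
def Premotive [PartialOrder α] (G : Game α) : Prop :=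
  ∀ G', IsFollower G' G → LocallyPremotive G'

/-- The game `* = ⟨0|0⟩` over the one-element poset. -/
def star : Game Unit := comp Unit Unit (fun _ => atom ()) (fun _ => atom ()) ⟨()⟩ ⟨()⟩

/-- `G + *`, identified with a game over `α` via the isomorphism `α × 1 ≅ α`. -/
noncomputable def addStar (G : Game α) : Game α := map Prod.fst (G.add star)

/-- A game is locally `*`-antimonotone if `G^L + * ≤ G ≤ G^R + *` for all left and
right options `G^L`, `G^R`. -/
def LocallyStarAnti [PartialOrder α] (G : Game α) : Prop :=
  (∀ G', IsLeftOption G' G → Le G'.addStar G) ∧ (∀ G', IsRightOption G' G → Le G G'.addStar)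

/-- A game is `*`-antimonotone if it and all of its followers are locally
`*`-antimonotone. -/
def StarAnti [PartialOrder α] (G : Game α) : Prop :=
  ∀ G', IsFollower G' G → LocallyStarAnti G'

/-- `ε(G + X)`: the game `G` over `α` embedded in a context `X`, a game over the poset
`[α, 𝔹]` of monotone functions `α → 𝔹`, via the application map `ε(a, f) = f a`. -/
noncomputable def ctxSum [PartialOrder α] (G : Game α) (X : Game (α →o Bool)) : Game Bool :=
  map (fun p : α × (α →o Bool) => p.2 p.1) (G.add X)

/-- The outcome `(o_L(G), o_R(G)) ∈ 𝔹 × 𝔹` of a game over the boolean poset: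
`o_L(G) = ⊤` iff Left has a first player winning strategy and `o_R(G) = ⊤` iff
Left has a second player winning strategy. -/
noncomputable def outcome (G : Game Bool) : Bool × Bool :=
  (@decide (LeftWinsFirst G) (Classical.propDecidable _),
   @decide (LeftWinsSecond G) (Classical.propDecidable _))

/-- The contextual order `G ≤_c H`: `o(G+X) ≤ o(H+X)` for every context `X`. -/
def ContextualLe [PartialOrder α] (G H : Game α) : Prop :=
  ∀ X : Game (α →o Bool), outcome (ctxSum G X) ≤ outcome (ctxSum H X)

/-- The contextual relation `G ◁_c H`: `o_R(G+X) ≤ o_L(H+X)` for every context `X`. -/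
def ContextualTri [PartialOrder α] (G H : Game α) : Prop :=
  ∀ X : Game (α →o Bool), (outcome (ctxSum G X)).2 ≤ (outcome (ctxSum H X)).1

/-- Two games are identical when they are equal as set-based games: both are the same
atom, or both are composite with identical sets of left options and identical sets of
right options (recursively). -/
def Identical : Game α → Game α → Prop
  | atom a, atom b => a = b
  | comp _ _ L R _ _, comp _ _ L' R' _ _ =>
      ((∀ i, ∃ i', Identical (L i) (L' i')) ∧ (∀ i', ∃ i, Identical (L i) (L' i'))) ∧
      ((∀ k, ∃ k', Identical (R k) (R' k')) ∧ (∀ k', ∃ k, Identical (R k) (R' k')))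
  | _, _ => False

theorem left_sum {γ : Type} (f : α × β → γ) (G : Game α) (H : Game β) (Z : Game γ) :
    IsLeftOption Z (map f (add G H)) ↔
      (∃ G', IsLeftOption G' G ∧ Z = map f (add G' H)) ∨
      (∃ H', IsLeftOption H' H ∧ Z = map f (add G H')) := by
  cases G <;> cases H <;> simp [add, map, IsLeftOption, eq_comm]

theorem right_sum {γ : Type} (f : α × β → γ) (G : Game α) (H : Game β) (Z : Game γ) :
    IsRightOption Z (map f (add G H)) ↔
      (∃ G', IsRightOption G' G ∧ Z = map f (add G' H)) ∨
      (∃ H', IsRightOption H' H ∧ Z = map f (add G H')) := by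
  cases G <;> cases H <;> simp [add, map, IsRightOption, eq_comm]

theorem sum_eq_atom {γ : Type} (f : α × β → γ) (G : Game α) (H : Game β) (b : γ) :
    map f (add G H) = atom b ↔ ∃ g h, G = atom g ∧ H = atom h ∧ f (g, h) = b := by
  cases G <;> cases H <;> simp [add, map]

theorem left_dual (G : Game α) (Z : Game αᵒᵈ) :
    IsLeftOption Z G.dual ↔ ∃ G', IsRightOption G' G ∧ Z = G'.dual := by
  cases G <;> simp [dual, IsLeftOption, IsRightOption, eq_comm]

theorem right_dual (G : Game α) (Z : Game αᵒᵈ) :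
    IsRightOption Z G.dual ↔ ∃ G', IsLeftOption G' G ∧ Z = G'.dual := by
  cases G <;> simp [dual, IsLeftOption, IsRightOption, eq_comm]

theorem dual_eq_atom (G : Game α) (a : αᵒᵈ) :
    G.dual = atom a ↔ G = atom (OrderDual.ofDual a) := by
  cases G <;> simp [dual]
  constructor <;> (intro h; subst h; rfl)

theorem first_iff (Z : Game Bool) :
    LeftWinsFirst Z ↔ Z = atom true ∨ ∃ Z', IsLeftOption Z' Z ∧ LeftWinsSecond Z' := by
  constructor
  · intro h
    cases h with
    | atom_top => exact Or.inl rfl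
    | move a b => exact Or.inr ⟨_, a, b⟩
  · rintro (h | ⟨Z', a, b⟩)
    · subst h; exact .atom_top
    · exact .move a b

theorem second_iff (Z : Game Bool) :
    LeftWinsSecond Z ↔ (∀ Z', IsRightOption Z' Z → LeftWinsFirst Z') ∧
      ∀ b, Z = atom b → b = true :=
  ⟨fun h => by cases h with | mk a b => exact ⟨a, b⟩, fun h => .mk h.1 h.2⟩

section
variable [PartialOrder α]

theorem ctx_first (G : Game α) (X : Game (α →o Bool)) :
    LeftWinsFirst (ctxSum G X) ↔
      (∃ g f, G = atom g ∧ X = atom f ∧ f g = true) ∨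
      (∃ G', IsLeftOption G' G ∧ LeftWinsSecond (ctxSum G' X)) ∨
      (∃ X', IsLeftOption X' X ∧ LeftWinsSecond (ctxSum G X')) := by
  rw [first_iff]
  unfold ctxSum
  rw [sum_eq_atom]
  simp only [left_sum]
  refine or_congr Iff.rfl ?_
  constructor
  · rintro ⟨Z', (⟨G', a, rfl⟩ | ⟨X', a, rfl⟩), b⟩
    · exact Or.inl ⟨_, a, b⟩
    · exact Or.inr ⟨_, a, b⟩
  · rintro (⟨G', a, b⟩ | ⟨X', a, b⟩)
    · exact ⟨_, Or.inl ⟨_, a, rfl⟩, b⟩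
    · exact ⟨_, Or.inr ⟨_, a, rfl⟩, b⟩

theorem ctx_second (G : Game α) (X : Game (α →o Bool)) :
    LeftWinsSecond (ctxSum G X) ↔
      (∀ g f, G = atom g → X = atom f → f g = true) ∧
      (∀ G', IsRightOption G' G → LeftWinsFirst (ctxSum G' X)) ∧
      (∀ X', IsRightOption X' X → LeftWinsFirst (ctxSum G X')) := by
  rw [second_iff]
  unfold ctxSum
  simp only [sum_eq_atom, right_sum]
  constructor
  · rintro ⟨h1, h2⟩
    exact ⟨fun g f a b => h2 _ ⟨g, f, a, b, rfl⟩, fun G' a => h1 _ (Or.inl ⟨_, a, rfl⟩),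
      fun X' a => h1 _ (Or.inr ⟨_, a, rfl⟩)⟩
  · rintro ⟨h1, h2, h3⟩
    refine ⟨?_, ?_⟩
    · rintro Z' (⟨G', a, rfl⟩ | ⟨X', a, rfl⟩)
      · exact h2 _ a
      · exact h3 _ a
    · rintro b ⟨g, f, a, b, rfl⟩
      exact h1 _ _ a b

theorem left_cmp (G H : Game α) (Z : Game Bool) : IsLeftOption Z (comparison G H) ↔
    (∃ G', IsRightOption G' G ∧ Z = comparison G' H) ∨
    (∃ H', IsLeftOption H' H ∧ Z = comparison G H') := by
  unfold comparison
  rw [left_sum]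
  simp only [left_dual]
  refine or_congr ?_ Iff.rfl
  constructor
  · rintro ⟨_, ⟨G', a, rfl⟩, b⟩; exact ⟨G', a, b⟩
  · rintro ⟨G', a, b⟩; exact ⟨_, ⟨G', a, rfl⟩, b⟩

theorem right_cmp (G H : Game α) (Z : Game Bool) : IsRightOption Z (comparison G H) ↔
    (∃ G', IsLeftOption G' G ∧ Z = comparison G' H) ∨
    (∃ H', IsRightOption H' H ∧ Z = comparison G H') := by
  unfold comparison
  rw [right_sum]
  simp only [right_dual]
  refine or_congr ?_ Iff.rfl
  constructor
  · rintro ⟨_, ⟨G', a, rfl⟩, b⟩; exact ⟨G', a, b⟩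
  · rintro ⟨G', a, b⟩; exact ⟨_, ⟨G', a, rfl⟩, b⟩

theorem cmp_atom_top (G H : Game α) (h : comparison G H = atom true) :
    ∃ g k, G = atom g ∧ H = atom k ∧ g ≤ k := by
  unfold comparison at h
  rw [sum_eq_atom] at h
  obtain ⟨g, k, a, b, c⟩ := h
  rw [dual_eq_atom] at a
  exact ⟨_, k, a, b, by simpa using c⟩

theorem Even.opt {G G' : Game α} (h : Even G) (o : IsOption G' G) : Odd G' := by
  cases h with | mk a => exact a _ o

theorem Odd.opt {G G' : Game α} (h : Odd G) (o : IsOption G' G) : Even G' := by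
  cases h with | mk _ a => exact a _ o

theorem Odd.not_atom {a : α} (h : Odd (atom a)) : False := by
  cases h with | mk c _ => exact c

theorem Odd.exists_left {G : Game α} (h : Odd G) : ∃ G', IsLeftOption G' G := by
  cases G with
  | atom a => exact h.not_atom.elim
  | comp ι κ L R hι hκ => exact ⟨L hι.some, _, rfl⟩

theorem Odd.exists_right {G : Game α} (h : Odd G) : ∃ G', IsRightOption G' G := by
  cases G with
  | atom a => exact h.not_atom.elim
  | comp ι κ L R hι hκ => exact ⟨R hκ.some, _, rfl⟩

/-- Games of mismatching parity are never intrinsically comparable. -/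
theorem Le.parity {G H : Game α} (h : Le G H) : MismatchParity G H → False := by
  refine Le.rec (motive_1 := fun G H _ => MismatchParity G H → False)
    (motive_2 := fun G H _ => Even G → Even H → False) ?_ ?_ ?_ h
  · rintro G H _ _ _ ih1 ih2 (⟨a, b⟩ | ⟨a, b⟩)
    · obtain ⟨H', o⟩ := b.exists_right
      exact ih2 _ o a (b.opt (Or.inr o))
    · obtain ⟨G', o⟩ := a.exists_left
      exact ih1 _ o (a.opt (Or.inl o)) b
  · intro G H G' o _ ih a b
    exact ih (Or.inr ⟨a.opt (Or.inr o), b⟩)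
  · intro G H H' o _ ih a b
    exact ih (Or.inl ⟨a, b.opt (Or.inl o)⟩)

/-- Outcome transfer along the comparison game, in an atomic context. -/
theorem cmp_transfer (f : α →o Bool) {Z : Game Bool} (h : LeftWinsSecond Z) :
    ∀ G H : Game α, Z = comparison G H →
      (Even G → Odd H → LeftWinsSecond (ctxSum G (atom f)) →
        LeftWinsSecond (ctxSum H (atom f))) ∧
      (Odd G → Even H → LeftWinsFirst (ctxSum G (atom f)) →
        LeftWinsFirst (ctxSum H (atom f))) := by
  refine LeftWinsSecond.rec
    (motive_1 := fun Z _ => ∀ G H : Game α, Z = comparison G H → Even G → Even H →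
      LeftWinsSecond (ctxSum G (atom f)) → LeftWinsFirst (ctxSum H (atom f)))
    (motive_2 := fun Z _ => ∀ G H : Game α, Z = comparison G H →
      (Even G → Odd H → LeftWinsSecond (ctxSum G (atom f)) →
        LeftWinsSecond (ctxSum H (atom f))) ∧
      (Odd G → Even H → LeftWinsFirst (ctxSum G (atom f)) →
        LeftWinsFirst (ctxSum H (atom f)))) ?_ ?_ ?_ h
  · intro G H e _ _ w
    obtain ⟨g, k, rfl, rfl, le⟩ := cmp_atom_top G H e.symm
    have hg := ((ctx_second _ _).1 w).1 g f rfl rfl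
    refine (ctx_first _ _).2 (Or.inl ⟨k, f, rfl, rfl, ?_⟩)
    have := f.monotone le
    rw [hg] at this
    exact this rfl
  · intro Z Z' o _ ih G H e eG eH w
    subst e
    rcases (left_cmp _ _ _).1 o with ⟨G', o', e⟩ | ⟨H', o', e⟩
    · exact (ih G' H e).2 (eG.opt (Or.inr o')) eH (((ctx_second _ _).1 w).2.1 _ o')
    · exact (ctx_first _ _).2 (Or.inr (Or.inl ⟨H', o',
        (ih G H' e).1 eG (eH.opt (Or.inl o')) w⟩))
  · intro Z _ _ ih G H e
    subst e
    constructor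
    · intro eG oH w
      refine (ctx_second _ _).2 ⟨?_, ?_, ?_⟩
      · rintro g _ rfl _
        exact oH.not_atom.elim
      · intro H' o
        exact ih _ ((right_cmp _ _ _).2 (Or.inr ⟨H', o, rfl⟩)) G H' rfl eG
          (oH.opt (Or.inr o)) w
      · intro X' o
        exact o.elim
    · intro oG eH w
      rcases (ctx_first _ _).1 w with ⟨g, _, rfl, _⟩ | ⟨G', o, w'⟩ | ⟨X', o, _⟩
      · exact oG.not_atom.elim
      · exact ih _ ((right_cmp _ _ _).2 (Or.inl ⟨G', o, rfl⟩)) G' H rfl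
          (oG.opt (Or.inl o)) eH w'
      · exact o.elim

/-- Even locally premotive games have `o_R ≤ o_L` in atomic contexts. -/
theorem even_tempo (f : α →o Bool) {G : Game α} (hp : LocallyPremotive G) (e : Even G)
    (w : LeftWinsSecond (ctxSum G (atom f))) : LeftWinsFirst (ctxSum G (atom f)) := by
  rcases (first_iff _).1 hp with h | ⟨Z, o, s⟩
  · obtain ⟨g, k, rfl, _, _⟩ := cmp_atom_top G G h
    exact (ctx_first _ _).2 (Or.inl ⟨g, f, rfl, rfl, ((ctx_second _ _).1 w).1 g f rfl rfl⟩)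
  · rcases (left_cmp _ _ _).1 o with ⟨G', o', e'⟩ | ⟨G', o', e'⟩
    · exact (cmp_transfer f s G' G e').2 (e.opt (Or.inr o')) e
        (((ctx_second _ _).1 w).2.1 _ o')
    · exact (ctx_first _ _).2 (Or.inr (Or.inl ⟨G', o',
        (cmp_transfer f s G G' e').1 e (e.opt (Or.inl o')) w⟩))

theorem Premotive.opt {G G' : Game α} (h : Premotive G) (o : IsOption G' G) : Premotive G' :=
  fun _ k => h _ (k.tail o)

theorem HasParity.opt {G G' : Game α} (h : HasParity G) (o : IsOption G' G) : HasParity G' :=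
  h.elim (fun h => Or.inr (h.opt o)) (fun h => Or.inl (h.opt o))

/-- Premotive with parity. -/
def Good (G : Game α) : Prop := Premotive G ∧ HasParity G

theorem Good.opt {G G' : Game α} (h : Good G) (o : IsOption G' G) : Good G' :=
  ⟨h.1.opt o, h.2.opt o⟩

theorem even_atom (a : α) : Even (atom a) := .mk fun _ o => (Or.elim o id id : False).elim

/-- The inductive step, for one fixed context. -/
theorem main_step (X : Game (α →o Bool))
    (ihL : ∀ X', IsLeftOption X' X → ∀ G H : Game α, Good G → Good H → Le G H →
      LeftWinsSecond (ctxSum G X') → LeftWinsSecond (ctxSum H X'))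
    (ihR : ∀ X', IsRightOption X' X → ∀ G H : Game α, Good G → Good H → Le G H →
      LeftWinsFirst (ctxSum G X') → LeftWinsFirst (ctxSum H X'))
    {G H : Game α} (h : Le G H) : Good G → Good H →
      (LeftWinsSecond (ctxSum G X) → LeftWinsSecond (ctxSum H X)) ∧
      (LeftWinsFirst (ctxSum G X) → LeftWinsFirst (ctxSum H X)) := by
  refine Le.rec
    (motive_1 := fun G H _ => Good G → Good H →
      (LeftWinsSecond (ctxSum G X) → LeftWinsSecond (ctxSum H X)) ∧
      (LeftWinsFirst (ctxSum G X) → LeftWinsFirst (ctxSum H X)))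
    (motive_2 := fun G H _ => Good G → Good H →
      LeftWinsSecond (ctxSum G X) → LeftWinsFirst (ctxSum H X)) ?_ ?_ ?_ h
  · intro G H t1 t2 t3 ih1 ih2 gG gH
    have hle : Le G H := .mk t1 t2 t3
    have hpar := hle.parity
    have hR : LeftWinsSecond (ctxSum G X) → LeftWinsSecond (ctxSum H X) := by
      intro w
      refine (ctx_second _ _).2 ⟨?_, ?_, ?_⟩
      · rintro k f rfl rfl
        have eG : Even G := gG.2.resolve_right fun o => hpar (Or.inr ⟨o, even_atom k⟩)
        have w' := even_tempo f (gG.1 _ .refl) eG w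
        rcases (ctx_first _ _).1 w' with ⟨g, f', rfl, e, hg⟩ | ⟨G', o, w''⟩ | ⟨X', o, _⟩
        · cases e
          have := f.monotone (t3 g k rfl rfl)
          rw [hg] at this
          exact this rfl
        · have := ih1 G' o (gG.opt (Or.inl o)) gH w''
          rcases (ctx_first _ _).1 this with ⟨g, f', e1, e2, hg⟩ | ⟨_, o, _⟩ | ⟨_, o, _⟩
          · cases e1; cases e2; exact hg
          · exact o.elim
          · exact o.elim
        · exact o.elim
      · intro H' o
        exact ih2 H' o gG (gH.opt (Or.inr o)) w
      · intro X' o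
        exact ihR X' o G H gG gH hle (((ctx_second _ _).1 w).2.2 X' o)
    refine ⟨hR, ?_⟩
    intro w
    rcases (ctx_first _ _).1 w with ⟨g, f, rfl, rfl, hg⟩ | ⟨G', o, w'⟩ | ⟨X', o, w'⟩
    · have eH : Even H := gH.2.resolve_right fun o => hpar (Or.inl ⟨even_atom g, o⟩)
      refine even_tempo f (gH.1 _ .refl) eH (hR ((ctx_second _ _).2 ⟨?_, ?_, ?_⟩))
      · intro g' f' e1 e2
        cases e1; cases e2; exact hg
      · intro _ o; exact o.elim
      · intro _ o; exact o.elim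
    · exact ih1 G' o (gG.opt (Or.inl o)) gH w'
    · exact (ctx_first _ _).2 (Or.inr (Or.inr ⟨X', o, ihL X' o G H gG gH hle w'⟩))
  · intro G H G' o _ ih gG gH w
    exact (ih (gG.opt (Or.inr o)) gH).2 (((ctx_second _ _).1 w).2.1 G' o)
  · intro G H H' o _ ih gG gH w
    exact (ctx_first _ _).2 (Or.inr (Or.inl ⟨H', o, (ih gG (gH.opt (Or.inl o))).1 w⟩))

theorem main_ctx (X : Game (α →o Bool)) : ∀ G H : Game α, Good G → Good H → Le G H →
    (LeftWinsSecond (ctxSum G X) → LeftWinsSecond (ctxSum H X)) ∧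
    (LeftWinsFirst (ctxSum G X) → LeftWinsFirst (ctxSum H X)) := by
  induction X with
  | atom f =>
    intro G H gG gH h
    exact main_step (atom f) (fun _ o => o.elim) (fun _ o => o.elim) h gG gH
  | comp ι κ L R hι hκ ihL ihR =>
    intro G H gG gH h
    refine main_step _ ?_ ?_ h gG gH
    · rintro _ ⟨i, rfl⟩ G H a b c
      exact (ihL i G H a b c).1
    · rintro _ ⟨i, rfl⟩ G H a b c
      exact (ihR i G H a b c).2

end

/-- For premotive games with parity, the intrinsic order implies the
contextual order. -/
theorem intrinsic_implies_contextual {α : Type} [PartialOrder α] (G H : Game α)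
    (hGp : Premotive G) (hHp : Premotive H) (hGpar : HasParity G) (hHpar : HasParity H)
    (h : Le G H) : ContextualLe G H := by
  intro X
  have m := main_ctx X G H ⟨hGp, hGpar⟩ ⟨hHp, hHpar⟩ h
  refine Prod.mk_le_mk.2 ⟨?_, ?_⟩
  · intro w
    exact @decide_eq_true _ (Classical.propDecidable _) (m.2 (@of_decide_eq_true _ (Classical.propDecidable _) w))
  · intro w
    exact @decide_eq_true _ (Classical.propDecidable _) (m.1 (@of_decide_eq_true _ (Classical.propDecidable _) w))

end Game
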